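/- For every ε > 0 there exists n₀ such that for all n ≥ n₀, τ_E(D_n) > (1/2)·C(n−1,2) + (1/4 − ε)·log n, where C(n−1,2) = (n−1)(n−2)/2 and log is the natural logarithm; that is, Avoider has a strategy guaranteeing that some vertex of [n] remains incident with no edge claimed by Avoider throughout his first ⌊(1/2)·C(n−1,2) + (1/4 − ε)·log n⌋ moves. -/

import Mathlib

/-- An edge of the complete graph `K_n` on vertex set `Fin n`:
a non-diagonal element of `Sym2 (Fin n)`. -/
abbrev Edge (n : ℕ) := {e : Sym2 (Fin n) // ¬ e.IsDiag}

/-- A position in the game: the pair (edges claimed by Avoider, edges claimed by Enforcer). -/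
abbrev Position (n : ℕ) := Finset (Edge n) × Finset (Edge n)

/-- A strategy assigns to each position an edge to claim. -/
abbrev Strategy (n : ℕ) := Position n → Edge n

/-- A strategy is legal if, whenever some edge is still unclaimed,
it selects a previously unclaimed edge. -/
def Legal (n : ℕ) (s : Strategy n) : Prop :=
  ∀ p : Position n, p.1 ∪ p.2 ≠ Finset.univ → s p ∉ p.1 ∪ p.2

/-- The position after `t` full rounds, Avoider moving first in each round. -/
def play (n : ℕ) (sA sE : Strategy n) : ℕ → Position n
  | 0 => (∅, ∅)
  | t + 1 =>
    let p := play n sA sE t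
    let a : Finset (Edge n) := insert (sA p) p.1
    (a, insert (sE (a, p.2)) p.2)

/-- Enforcer can force Avoider's claimed edge set to contain a losing set of `F`
by the end of Avoider's `t`-th move. -/
def EnforcerWinsBy (n : ℕ) (F : Set (Finset (Edge n))) (t : ℕ) : Prop :=
  ∃ sE : Strategy n, Legal n sE ∧ ∀ sA : Strategy n, Legal n sA →
    ∃ L ∈ F, L ⊆ (play n sA sE t).1

/-- The minimum number of moves Enforcer needs to win the Avoider–Enforcer game on `F`;
`⊤` if Enforcer cannot win. -/
noncomputable def tauE (n : ℕ) (F : Set (Finset (Edge n))) : ℕ∞ :=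
  sInf ((fun t : ℕ => (t : ℕ∞)) '' {t : ℕ | EnforcerWinsBy n F t})

/-- `D_n`: the family of edge sets of graphs on `Fin n` with minimum degree at least 1,
i.e. every vertex is incident with some claimed edge. -/
def Dfam (n : ℕ) : Set (Finset (Edge n)) :=
  {E | ∀ v : Fin n, ∃ e ∈ E, v ∈ e.val}

/-- The position after Avoider claims `e` in position `p` and Enforcer answers following `sE`. -/
def respond {n : ℕ} (sE : Strategy n) (p : Position n) (e : Edge n) : Position n :=
  (insert e p.1, insert (sE (insert e p.1, p.2)) p.2)

/-- `q` arises from `p` by one round in which Avoider claims a free edge. -/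
def Round {n : ℕ} (sE : Strategy n) (p q : Position n) : Prop :=
  ∃ e, e ∉ p.1 ∪ p.2 ∧ q = respond sE p e

/-- `q` can be reached from the initial position against `sE`. -/
abbrev Reachable {n : ℕ} (sE : Strategy n) (q : Position n) : Prop :=
  Relation.ReflTransGen (Round sE) (∅, ∅) q

/-- The vertex `v` is incident with no edge of `E`. -/
def Isolated {n : ℕ} (E : Finset (Edge n)) (v : Fin n) : Prop :=
  ∀ e ∈ E, v ∉ e.val

/-- Against `sE`, Avoider has made fewer than `T` moves in each reachable position in which his
graph has an isolated vertex. -/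
def CoveredBy {n : ℕ} (sE : Strategy n) (T : ℕ) : Prop :=
  ∀ q, Reachable sE q → (∃ v, Isolated q.1 v) → q.1.card < T

theorem Round.subset {n : ℕ} {sE : Strategy n} {p q : Position n} (h : Round sE p q) :
    p.1 ⊆ q.1 ∧ p.2 ⊆ q.2 := by
  obtain ⟨e, -, rfl⟩ := h
  exact ⟨Finset.subset_insert _ _, Finset.subset_insert _ _⟩

theorem Round.card {n : ℕ} {sE : Strategy n} {p q : Position n} (h : Round sE p q) :
    q.1.card = p.1.card + 1 := by
  obtain ⟨e, he, rfl⟩ := h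
  exact Finset.card_insert_of_notMem fun h => he (Finset.mem_union_left _ h)

theorem subset_of_reflTransGen_round {n : ℕ} {sE : Strategy n} {p q : Position n}
    (h : Relation.ReflTransGen (Round sE) p q) : p.1 ⊆ q.1 ∧ p.2 ⊆ q.2 := by
  induction h with
  | refl => exact ⟨subset_rfl, subset_rfl⟩
  | tail _ hr ih => exact ⟨ih.1.trans hr.subset.1, ih.2.trans hr.subset.2⟩

theorem play_fst_mono {n : ℕ} (sA sE : Strategy n) : Monotone fun t => (play n sA sE t).1 :=
  monotone_nat_of_le_succ fun _ => Finset.subset_insert _ _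

theorem exists_legal_play_eq {n : ℕ} (sE : Strategy n) {q : Position n} (hq : Reachable sE q) :
    ∃ sA : Strategy n, Legal n sA ∧ play n sA sE q.1.card = q := by
  classical
  let good (p : Position n) (e : Edge n) : Prop :=
    e ∉ p.1 ∪ p.2 ∧ Relation.ReflTransGen (Round sE) (respond sE p e) q
  let sA : Strategy n := fun p =>
    if h : ∃ e, good p e then h.choose
    else if h : ∃ e, e ∉ p.1 ∪ p.2 then h.choose else sE p
  have good_sA {p : Position n} (h : ∃ e, good p e) : good p (sA p) := by
    simp only [sA, dif_pos h]
    exact h.choose_spec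
  refine ⟨sA, fun p hp => ?_, ?_⟩
  · by_cases h : ∃ e, good p e
    · exact (good_sA h).1
    · have h' : ∃ e, e ∉ p.1 ∪ p.2 := by
        by_contra! h'
        exact hp (Finset.eq_univ_iff_forall.2 h')
      simp only [sA, dif_neg h, dif_pos h']
      exact h'.choose_spec
  · have key : ∀ i ≤ q.1.card, (play n sA sE i).1.card = i ∧
        Relation.ReflTransGen (Round sE) (play n sA sE i) q := by
      intro i
      induction i with
      | zero => exact fun _ => ⟨rfl, hq⟩
      | succ i ih =>
        intro hi
        obtain ⟨hc, hr⟩ := ih (by omega)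
        rcases hr.cases_head with h | ⟨r, ⟨e, he, rfl⟩, hr⟩
        · rw [h] at hc
          omega
        · have hg := good_sA ⟨e, he, hr⟩
          refine ⟨?_, hg.2⟩
          have hround : Round sE (play n sA sE i) (play n sA sE (i + 1)) := ⟨_, hg.1, rfl⟩
          rw [hround.card, hc]
    obtain ⟨hc, hr⟩ := key _ le_rfl
    rcases hr.cases_head with h | ⟨r, hs, hr⟩
    · exact h
    · have := Finset.card_le_card (subset_of_reflTransGen_round hr).1
      have := hs.card
      omega

theorem not_enforcerWinsBy {n T t : ℕ} (h : ∀ sE, Legal n sE → ¬ CoveredBy sE T) (ht : t ≤ T) :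
    ¬ EnforcerWinsBy n (Dfam n) t := by
  rintro ⟨sE, hE, hw⟩
  have := h sE hE
  simp only [CoveredBy] at this
  push Not at this
  obtain ⟨q, hq, ⟨v, hv⟩, hT⟩ := this
  obtain ⟨sA, hA, hplay⟩ := exists_legal_play_eq sE hq
  obtain ⟨L, hL, hsub⟩ := hw sA hA
  obtain ⟨e, he, hve⟩ := hL v
  refine hv e ?_ hve
  rw [← hplay]
  exact play_fst_mono sA sE (ht.trans hT) (hsub he)

theorem Reachable.card_eq_and_disjoint {n T : ℕ} {sE : Strategy n} (hE : Legal n sE)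
    (hT : 2 * T ≤ Fintype.card (Edge n)) (H : CoveredBy sE T) {q : Position n}
    (hq : Reachable sE q) (hv : ∃ v, Isolated q.1 v) :
    q.1.card = q.2.card ∧ Disjoint q.1 q.2 := by
  induction hq with
  | refl => simp
  | @tail p q hp hr ih =>
    have hvp : ∃ v, Isolated p.1 v := hv.imp fun v h e he => h e (hr.subset.1 he)
    obtain ⟨hc, hd⟩ := ih hvp
    have hlt := H p hp hvp
    have hcard := hr.card
    obtain ⟨e, he, rfl⟩ := hr
    have hne : insert e p.1 ∪ p.2 ≠ Finset.univ := by
      intro h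
      have h1 := Finset.card_union_le (insert e p.1) p.2
      have h2 := Finset.card_insert_le e p.1
      rw [h, Finset.card_univ] at h1
      omega
    have hs := hE (insert e p.1, p.2) hne
    simp only [Finset.mem_union, not_or] at hs he
    refine ⟨?_, ?_⟩
    · rw [hcard]
      simp only [respond]
      rw [Finset.card_insert_of_notMem hs.2, hc]
    · simp only [respond]
      rw [Finset.disjoint_insert_right, Finset.disjoint_insert_left]
      exact ⟨hs.1, he.2, hd⟩

/-- The edges with both ends in `J`. -/
def inside {n : ℕ} (J : Finset (Fin n)) : Finset (Edge n) :=
  Finset.univ.filter fun e => ∀ v ∈ e.val, v ∈ J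

/-- The edges joining `J` to `u`, for `u ∉ J`. -/
def spokes {n : ℕ} (J : Finset (Fin n)) (u : Fin n) : Finset (Edge n) :=
  inside (insert u J) \ inside J

@[simp]
theorem mem_inside {n : ℕ} {J : Finset (Fin n)} {e : Edge n} :
    e ∈ inside J ↔ ∀ v ∈ e.val, v ∈ J := by
  simp [inside]

theorem inside_mono {n : ℕ} {J J' : Finset (Fin n)} (h : J ⊆ J') : inside J ⊆ inside J' :=
  fun _ he => mem_inside.2 fun v hv => h (mem_inside.1 he v hv)

theorem mem_of_mem_spokes {n : ℕ} {J : Finset (Fin n)} {u : Fin n} {e : Edge n}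
    (he : e ∈ spokes J u) : u ∈ e.val ∧ ∀ v ∈ e.val, v = u ∨ v ∈ J := by
  simp only [spokes, Finset.mem_sdiff, mem_inside, Finset.mem_insert] at he
  refine ⟨?_, he.1⟩
  by_contra hu
  exact he.2 fun v hv => (he.1 v hv).resolve_left fun h => hu (h ▸ hv)

theorem spokes_subset_spokes {n : ℕ} {J J' : Finset (Fin n)} {u : Fin n} (h : J ⊆ J')
    (hu : u ∉ J') : spokes J u ⊆ spokes J' u := by
  intro e he
  obtain ⟨hue, hv⟩ := mem_of_mem_spokes he
  simp only [spokes, Finset.mem_sdiff, mem_inside, Finset.mem_insert]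
  exact ⟨fun v hve => (hv v hve).imp_right fun h' => h h', fun h' => hu (h' u hue)⟩

theorem disjoint_spokes {n : ℕ} {J : Finset (Fin n)} {u w : Fin n} (hu : u ∉ J) (huw : u ≠ w) :
    Disjoint (spokes J u) (spokes J w) := by
  refine Finset.disjoint_left.2 fun e he he' => ?_
  rcases (mem_of_mem_spokes he').2 u (mem_of_mem_spokes he).1 with h | h
  · exact huw h
  · exact hu h

theorem card_spokes {n : ℕ} {J : Finset (Fin n)} {u : Fin n} (hu : u ∉ J) :
    (spokes J u).card = J.card := by
  symm
  have hne : ∀ w ∈ J, u ≠ w := fun w hw h => hu (h ▸ hw)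
  refine Finset.card_bij (fun w hw => ⟨s(u, w), by simpa using hne w hw⟩) ?_ ?_ ?_
  · intro w hw
    simp only [spokes, Finset.mem_sdiff, mem_inside, Sym2.mem_iff, Finset.mem_insert]
    refine ⟨?_, fun h => hu (h u (Or.inl rfl))⟩
    rintro v (rfl | rfl)
    · exact Or.inl rfl
    · exact Or.inr hw
  · intro w hw w' hw' h
    exact Sym2.congr_right.1 (Subtype.ext_iff.1 h)
  · intro e he
    obtain ⟨hue, hv⟩ := mem_of_mem_spokes he
    obtain ⟨w, hw⟩ := Sym2.mem_iff_exists.1 hue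
    have hwu : w ≠ u := by
      rintro rfl
      exact e.2 (by simp [hw])
    refine ⟨w, (hv w (by simp [hw])).resolve_left hwu, Subtype.ext hw.symm⟩

theorem card_inside_insert {n : ℕ} {J : Finset (Fin n)} {u : Fin n} (hu : u ∉ J) :
    (inside (insert u J)).card = (inside J).card + J.card := by
  rw [← card_spokes hu, spokes, add_comm,
    Finset.card_sdiff_add_card_eq_card (inside_mono (Finset.subset_insert u J))]

theorem card_inside {n : ℕ} (J : Finset (Fin n)) : (inside J).card = J.card.choose 2 := by
  induction J using Finset.induction_on with
  | empty =>
    rw [Finset.card_empty, Nat.choose_eq_zero_of_lt (by norm_num), Finset.card_eq_zero]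
    refine Finset.eq_empty_of_forall_notMem fun e he => ?_
    obtain ⟨u, hu⟩ : ∃ u, u ∈ e.val := by
      induction e.val with | _ x y => exact ⟨x, by simp⟩
    simpa using mem_inside.1 he u hu
  | insert u J hu ih =>
    rw [card_inside_insert hu, ih, Finset.card_insert_of_notMem hu, Nat.choose_succ_succ' _ 1,
      Nat.choose_one_right, add_comm]

theorem card_edge (n : ℕ) : Fintype.card (Edge n) = n.choose 2 := by
  have h := card_inside (Finset.univ : Finset (Fin n))
  rw [Finset.card_univ, Fintype.card_fin] at h
  rw [← h, ← Finset.card_univ]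
  congr 1
  ext e
  simp

/-- A reachable position in which Avoider has played only inside `J` and cannot do so any more. -/
structure Stuck {n : ℕ} (sE : Strategy n) (J : Finset (Fin n)) (q : Position n) : Prop where
  reachable : Reachable sE q
  fst_subset : q.1 ⊆ inside J
  inside_subset : inside J ⊆ q.1 ∪ q.2

theorem isolated_of_subset_inside {n : ℕ} {J : Finset (Fin n)} {E : Finset (Edge n)}
    (h : E ⊆ inside J) {v : Fin n} (hv : v ∉ J) : Isolated E v :=
  fun _ he hve => hv (mem_inside.1 (h he) v hve)

theorem Stuck.two_mul_card {n T : ℕ} {sE : Strategy n} (hE : Legal n sE)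
    (hT : 2 * T ≤ Fintype.card (Edge n)) (H : CoveredBy sE T) {J : Finset (Fin n)}
    {q : Position n} (h : Stuck sE J q) {v : Fin n} (hv : v ∉ J) :
    2 * q.1.card = (inside J).card + (q.2 \ inside J).card := by
  obtain ⟨hc, hd⟩ := h.reachable.card_eq_and_disjoint hE hT H
    ⟨v, isolated_of_subset_inside h.fst_subset hv⟩
  have h1 : q.1 ∪ q.2 = inside J ∪ (q.2 \ inside J) := by
    rw [Finset.union_sdiff_self_eq_union]
    exact subset_antisymm
      (Finset.union_subset_union_left h.fst_subset)
      (Finset.union_subset h.inside_subset Finset.subset_union_right)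
  rw [← Finset.card_union_of_disjoint Finset.disjoint_sdiff, ← h1,
    Finset.card_union_of_disjoint hd, ← hc, two_mul]

theorem exists_stuck {n : ℕ} {sE : Strategy n} (J : Finset (Fin n)) (p : Position n)
    (hp : Reachable sE p) (hsub : p.1 ⊆ inside J) : ∃ q, Stuck sE J q ∧ p.2 ⊆ q.2 := by
  induction hk : (inside J \ (p.1 ∪ p.2)).card using Nat.strong_induction_on generalizing p with
  | _ k ih =>
    by_cases h : inside J ⊆ p.1 ∪ p.2
    · exact ⟨p, ⟨hp, hsub, h⟩, subset_rfl⟩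
    obtain ⟨e, heJ, he⟩ := Finset.not_subset.1 h
    have hr : Round sE p (respond sE p e) := ⟨e, he, rfl⟩
    have hlt : (inside J \ ((respond sE p e).1 ∪ (respond sE p e).2)).card < k := by
      rw [← hk]
      refine Finset.card_lt_card (Finset.ssubset_iff_of_subset ?_ |>.2 ⟨e, ?_, ?_⟩)
      · exact Finset.sdiff_subset_sdiff subset_rfl
          (Finset.union_subset_union hr.subset.1 hr.subset.2)
      · exact Finset.mem_sdiff.2 ⟨heJ, he⟩
      · simp [respond]
    obtain ⟨q, hq, hsq⟩ := ih _ hlt _ (hp.tail hr)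
      (Finset.insert_subset heJ hsub) rfl
    exact ⟨q, hq, hr.subset.2.trans hsq⟩

/-- The state of a position stuck inside a set of `m` vertices: `y` of Enforcer's edges leave that
set, and every outside vertex is joined to it by at least `d` of them. -/
def StuckState {n : ℕ} (sE : Strategy n) (m y d : ℕ) : Prop :=
  ∃ J q, J.card = m ∧ Stuck sE J q ∧ (q.2 \ inside J).card = y ∧
    (∀ u ∉ J, d ≤ (q.2 ∩ spokes J u).card) ∧ ∃ u, u ∉ J ∧ (q.2 ∩ spokes J u).card = d

theorem StuckState.mul_le {n : ℕ} {sE : Strategy n} {m y d : ℕ} (h : StuckState sE m y d) :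
    (n - m) * d ≤ y := by
  obtain ⟨J, q, rfl, -, rfl, hd, -⟩ := h
  have hcard : Jᶜ.card = n - J.card := by rw [Finset.card_compl, Fintype.card_fin]
  calc (n - J.card) * d = Jᶜ.card • d := by rw [hcard, smul_eq_mul]
    _ ≤ ∑ u ∈ Jᶜ, (q.2 ∩ spokes J u).card :=
        Finset.card_nsmul_le_sum _ _ _ fun u hu => hd u (Finset.mem_compl.1 hu)
    _ = (Jᶜ.biUnion fun u => q.2 ∩ spokes J u).card := by
        refine (Finset.card_biUnion fun u hu w _ huw => ?_).symm
        exact (disjoint_spokes (Finset.mem_compl.1 hu) huw).mono Finset.inter_subset_right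
          Finset.inter_subset_right
    _ ≤ _ := by
        refine Finset.card_le_card (Finset.biUnion_subset.2 fun u _ e he => ?_)
        simp only [Finset.mem_inter, spokes, Finset.mem_sdiff] at he ⊢
        exact ⟨he.1, he.2.2⟩

theorem stuckState_zero {n : ℕ} (sE : Strategy n) (hn : 0 < n) : StuckState sE 0 0 0 := by
  refine ⟨∅, (∅, ∅), rfl, ⟨.refl, by simp, ?_⟩, by simp, by simp, ⟨0, hn⟩, by simp, by simp⟩
  rw [Finset.card_eq_zero.1 ((card_inside (∅ : Finset (Fin n))).trans (by simp))]
  simp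

theorem StuckState.exists_succ {n T : ℕ} {sE : Strategy n} (hE : Legal n sE)
    (hT : 2 * T ≤ Fintype.card (Edge n)) (H : CoveredBy sE T) {m y d : ℕ}
    (h : StuckState sE m y d) (hm : m + 1 < n) :
    ∃ x d', d ≤ d' ∧ d ≤ y ∧ Even (x + d + m) ∧ StuckState sE (m + 1) (y - d + x) d' := by
  obtain ⟨J, q, rfl, hs, rfl, hd, u, hu, rfl⟩ := h
  obtain ⟨q', hs', hqq'⟩ := exists_stuck (insert u J) q hs.reachable
    (hs.fst_subset.trans (inside_mono (Finset.subset_insert _ _)))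
  have hcard : (insert u J).card = J.card + 1 := Finset.card_insert_of_notMem hu
  have hne : (insert u J)ᶜ.Nonempty := by
    rw [← Finset.card_pos, Finset.card_compl, Fintype.card_fin, hcard]
    omega
  obtain ⟨w, hw, hmin⟩ := Finset.exists_min_image _
    (fun w => (q'.2 ∩ spokes (insert u J) w).card) hne
  rw [Finset.mem_compl] at hw
  have hsplit : (q.2 \ inside J).card =
      (q.2 ∩ spokes J u).card + (q.2 \ inside (insert u J)).card := by
    rw [← Finset.card_union_of_disjoint]
    · congr 1
      ext e
      have := @inside_mono n J _ (Finset.subset_insert u J) e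
      simp only [Finset.mem_union, Finset.mem_inter, spokes, Finset.mem_sdiff]
      tauto
    · refine Finset.disjoint_left.2 fun e he he' => ?_
      simp only [Finset.mem_inter, spokes, Finset.mem_sdiff] at he he'
      exact he'.2 he.2.1
  have hle : (q.2 \ inside (insert u J)).card ≤ (q'.2 \ inside (insert u J)).card :=
    Finset.card_le_card (Finset.sdiff_subset_sdiff hqq' subset_rfl)
  have h1 := hs.two_mul_card hE hT H hu
  have h2 := hs'.two_mul_card hE hT H hw
  have h3 := card_inside_insert hu
  refine ⟨(q'.2 \ inside (insert u J)).card - (q.2 \ inside (insert u J)).card,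
    (q'.2 ∩ spokes (insert u J) w).card, ?_, by omega, ?_,
    insert u J, q', hcard, hs', by omega, fun v hv => hmin v (Finset.mem_compl.2 hv), w, hw, rfl⟩
  · refine (hd w fun h => hw (Finset.mem_insert_of_mem h)).trans (Finset.card_le_card ?_)
    exact Finset.inter_subset_inter hqq' (spokes_subset_spokes (Finset.subset_insert _ _) hw)
  · rw [Nat.even_iff]
    omega

theorem StuckState.exists_add_two {n T K : ℕ} {sE : Strategy n} (hE : Legal n sE)
    (hT : 2 * T ≤ Fintype.card (Edge n)) (H : CoveredBy sE T) {m y d : ℕ}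
    (h : StuckState sE m y d) (hK : 0 < K) (hm : m + 2 + K ≤ n) :
    ∃ y' d', StuckState sE (m + 2) y' d' ∧
      (y : ℝ) / (n - m) + d / K + 1 / (n - m) ≤ y' / (n - m - 2) + d' / K := by
  obtain ⟨x, d₁, hd₁, hdy, hx, h₁⟩ := h.exists_succ hE hT H (by omega)
  obtain ⟨x', d₂, hd₂, hdy₁, hx', h₂⟩ := h₁.exists_succ hE hT H (by omega)
  refine ⟨_, _, h₂, ?_⟩
  have hpar : 1 ≤ x + x' + (d₁ - d) := by
    by_contra hc
    rw [Nat.even_iff] at hx hx'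
    omega
  have a₀ := h.mul_le
  have a₁ := h₁.mul_le
  set y₁ := y - d + x with hy₁
  obtain ⟨i, hi⟩ : ∃ i, n = m + 2 + i := ⟨n - (m + 2), by omega⟩
  have hiK : K ≤ i := by omega
  rw [show n - m = i + 2 by omega] at a₀
  rw [show n - (m + 1) = i + 1 by omega] at a₁
  have hi0 : (0 : ℝ) < i := by exact_mod_cast hK.trans_le hiK
  have hy₁' : (y₁ : ℝ) = y - d + x := by rw [hy₁]; push_cast [hdy]; ring
  have hy₂' : ((y₁ - d₁ + x' : ℕ) : ℝ) = y₁ - d₁ + x' := by push_cast [hdy₁]; ring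
  have e₁ : (n : ℝ) - m = i + 2 := by rw [hi]; push_cast; ring
  have e₂ : (n : ℝ) - m - 2 = i := by rw [e₁]; ring
  rw [hy₂', e₂, e₁]
  have b₀ : ((i : ℝ) + 2) * d ≤ y := by exact_mod_cast a₀
  have b₁ : ((i : ℝ) + 1) * d₁ ≤ y₁ := by exact_mod_cast a₁
  have s₁ : (y : ℝ) / (i + 2) + x / (i + 1) ≤ y₁ / (i + 1) := by
    rw [hy₁', add_div, add_le_add_iff_right, div_le_div_iff₀ (by positivity) (by positivity)]
    nlinarith
  have s₂ : (y₁ : ℝ) / (i + 1) + x' / i ≤ (y₁ - d₁ + x') / i := by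
    rw [add_div, add_le_add_iff_right, div_le_div_iff₀ (by positivity) (by positivity)]
    nlinarith
  have s₃ : (x' : ℝ) / (i + 1) ≤ x' / i := by gcongr; linarith
  have hd₁' : (d : ℝ) ≤ d₁ := by exact_mod_cast hd₁
  have hd₂' : (d₁ : ℝ) ≤ d₂ := by exact_mod_cast hd₂
  have hpar' : (1 : ℝ) ≤ x + x' + (d₁ - d) := by
    rw [← Nat.cast_sub hd₁]
    exact_mod_cast hpar
  have s₄ : (1 : ℝ) / (i + 1) ≤ x / (i + 1) + x' / (i + 1) + (d₁ - d) / (i + 1) := by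
    rw [← add_div, ← add_div]
    gcongr
  have hiK' : (K : ℝ) ≤ i + 1 := by
    have : (K : ℝ) ≤ i := by exact_mod_cast hiK
    linarith
  have hK' : (0 : ℝ) < K := by exact_mod_cast hK
  have s₅ : ((d₁ : ℝ) - d) / (i + 1) ≤ (d₂ - d) / K :=
    div_le_div₀ (by linarith) (by linarith) hK' hiK'
  have s₆ : (1 : ℝ) / (i + 2) ≤ 1 / (i + 1) := by gcongr; linarith
  rw [sub_div (d₂ : ℝ)] at s₅
  linarith

theorem half_log_sub_le {x : ℝ} (hx : 0 < x) :
    (Real.log (x + 2) - Real.log x) / 2 ≤ 1 / x := by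
  rw [← Real.log_div (by positivity) hx.ne']
  have h := Real.log_le_sub_one_of_pos (show 0 < (x + 2) / x by positivity)
  have : (x + 2) / x - 1 = 2 * (1 / x) := by field_simp; ring
  linarith

theorem exists_stuckState_potential {n T K : ℕ} {sE : Strategy n} (hE : Legal n sE)
    (hT : 2 * T ≤ Fintype.card (Edge n)) (H : CoveredBy sE T) (hK : 0 < K) (j : ℕ)
    (hj : 2 * j + K ≤ n) :
    ∃ y d, StuckState sE (2 * j) y d ∧
      (Real.log (n + 2) - Real.log (n - (2 * j : ℕ) + 2)) / 2 ≤
        (y : ℝ) / (n - (2 * j : ℕ)) + d / K := by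
  induction j with
  | zero => exact ⟨0, 0, stuckState_zero sE (by omega), by simp⟩
  | succ j ih =>
    obtain ⟨y, d, hs, hle⟩ := ih (by omega)
    obtain ⟨y', d', hs', hle'⟩ := hs.exists_add_two (K := K) hE hT H hK (by omega)
    refine ⟨y', d', hs', ?_⟩
    have hpos : (0 : ℝ) < n - (2 * j : ℕ) := by
      have : ((2 * j : ℕ) : ℝ) < n := by exact_mod_cast (by omega : 2 * j < n)
      linarith
    have hlog := half_log_sub_le hpos
    have e₁ : (n : ℝ) - (2 * (j + 1) : ℕ) = n - (2 * j : ℕ) - 2 := by push_cast; ring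
    rw [e₁, sub_add_cancel]
    linarith

theorem StuckState.exists_reachable {n T : ℕ} {sE : Strategy n} (hE : Legal n sE)
    (hT : 2 * T ≤ Fintype.card (Edge n)) (H : CoveredBy sE T) {m y d : ℕ}
    (h : StuckState sE m y d) (hm : m < n) :
    ∃ q k, Reachable sE q ∧ (∃ v, Isolated q.1 v) ∧ y ≤ (n - m) * k ∧
      2 * q.1.card = (n - 1).choose 2 + k := by
  obtain ⟨J, q, rfl, hs, rfl, -, -⟩ := h
  have hcard : Jᶜ.card = n - J.card := by rw [Finset.card_compl, Fintype.card_fin]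
  have hne : Jᶜ.Nonempty := by
    rw [← Finset.card_pos, hcard]
    omega
  let E (v : Fin n) : Finset (Edge n) := q.2.filter fun e => v ∈ e.val
  obtain ⟨v, hv, hmax⟩ := Finset.exists_max_image _ (fun v => (E v).card) hne
  rw [Finset.mem_compl] at hv
  have hJv : J ⊆ {v}ᶜ := fun w hw => by
    rw [Finset.mem_compl, Finset.mem_singleton]
    rintro rfl
    exact hv hw
  obtain ⟨q', hs', hqq'⟩ := exists_stuck {v}ᶜ q hs.reachable
    (hs.fst_subset.trans (inside_mono hJv))
  have hv' : v ∉ ({v}ᶜ : Finset (Fin n)) := by simp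
  refine ⟨q', (q'.2 \ inside {v}ᶜ).card, hs'.reachable,
    ⟨v, isolated_of_subset_inside hs'.fst_subset hv'⟩, ?_, ?_⟩
  · have hEv : (E v).card ≤ (q'.2 \ inside {v}ᶜ).card := by
      refine Finset.card_le_card fun e he => ?_
      simp only [E, Finset.mem_filter] at he
      rw [Finset.mem_sdiff, mem_inside]
      exact ⟨hqq' he.1, fun h => hv' (h v he.2)⟩
    calc (q.2 \ inside J).card ≤ (Jᶜ.biUnion E).card := by
          refine Finset.card_le_card fun e he => ?_
          rw [Finset.mem_sdiff, mem_inside] at he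
          obtain ⟨heq, he⟩ := he
          push Not at he
          obtain ⟨w, hwe, hw⟩ := he
          simp only [Finset.mem_biUnion, Finset.mem_compl, E, Finset.mem_filter]
          exact ⟨w, hw, heq, hwe⟩
      _ ≤ Jᶜ.card * (E v).card := Finset.card_biUnion_le_card_mul _ _ _ hmax
      _ ≤ _ := by rw [hcard]; gcongr
  · rw [hs'.two_mul_card hE hT H hv', card_inside, Finset.card_compl, Fintype.card_fin,
      Finset.card_singleton]

/-- Avoider can keep a vertex isolated for about `C(n-1,2)/2 + (log n - log (K+3))/4` moves. -/
theorem exists_reachable_card_ge {n T K : ℕ} {sE : Strategy n} (hE : Legal n sE)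
    (hT : 2 * T ≤ Fintype.card (Edge n)) (H : CoveredBy sE T) (hK : 0 < K) (hn : K ≤ n) :
    ∃ q, Reachable sE q ∧ (∃ v, Isolated q.1 v) ∧
      ((n - 1).choose 2 : ℝ) + (1 - 1 / (K + 1)) * ((Real.log n - Real.log (K + 3)) / 2) ≤
        2 * q.1.card := by
  obtain ⟨y, d, hs, hle⟩ := exists_stuckState_potential hE hT H hK ((n - K) / 2) (by omega)
  set m := 2 * ((n - K) / 2) with hm
  obtain ⟨q, k, hq, hv, hk, hcard⟩ := hs.exists_reachable hE hT H (by omega)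
  refine ⟨q, hq, hv, ?_⟩
  have hd := hs.mul_le
  obtain ⟨i, hi⟩ : ∃ i, n = m + i := ⟨n - m, by omega⟩
  have hiK : i ≤ K + 1 := by omega
  have hi0 : 0 < i := by omega
  rw [show n - m = i by omega] at hk hd
  have e : (n : ℝ) - m = i := by rw [hi]; push_cast; ring
  rw [e] at hle
  have hdk : (d : ℝ) ≤ k := by
    exact_mod_cast Nat.le_of_mul_le_mul_left (hd.trans hk) hi0
  have hi0' : (0 : ℝ) < i := by exact_mod_cast hi0
  have hK' : (0 : ℝ) < K := by exact_mod_cast hK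
  have hyk : (y : ℝ) / i ≤ k := by
    rw [div_le_iff₀' hi0']
    exact_mod_cast hk
  have hdK : (d : ℝ) / K ≤ k / K := by gcongr
  have hlog₁ : Real.log n ≤ Real.log (n + 2) :=
    Real.log_le_log (by exact_mod_cast hK.trans_le hn) (by linarith)
  have hlog₂ : Real.log (i + 2) ≤ Real.log (K + 3) := by
    refine Real.log_le_log (by linarith) ?_
    have : (i : ℝ) ≤ K + 1 := by exact_mod_cast hiK
    linarith
  have hcard' : (2 : ℝ) * q.1.card = (n - 1).choose 2 + k := by exact_mod_cast hcard
  rw [hcard']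
  have hfin : (Real.log n - Real.log (K + 3)) / 2 ≤ k * (1 + 1 / K) := by
    rw [mul_add, mul_one, mul_one_div]
    linarith
  have hc : (0 : ℝ) ≤ 1 - 1 / (K + 1) := by
    rw [sub_nonneg, div_le_one (by positivity)]
    linarith
  have := mul_le_mul_of_nonneg_left hfin hc
  have hone : (1 - 1 / ((K : ℝ) + 1)) * (k * (1 + 1 / K)) = k := by field_simp; ring
  linarith

theorem cast_pred_choose_two {n : ℕ} (hn : 1 ≤ n) :
    ((n - 1).choose 2 : ℝ) = ((n : ℝ) - 1) * (n - 2) / 2 := by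
  rw [Nat.cast_choose_two, Nat.cast_sub hn]
  push_cast
  ring

/-- for every `ε > 0` and every sufficiently large `n`,
`τ_E(D_n) > (1/2)·C(n-1,2) + (1/4 - ε)·log n`, i.e. (as `τ_E` is an integer)
`τ_E(D_n) > ⌊(n-1)(n-2)/4 + (1/4 - ε)·log n⌋`. -/
theorem tauE_mindegree_lower (ε : ℝ) (hε : 0 < ε) :
    ∃ n₀ : ℕ, ∀ n : ℕ, n₀ ≤ n →
      ((⌊((n : ℝ) - 1) * ((n : ℝ) - 2) / 4 + (1 / 4 - ε) * Real.log n⌋₊ : ℕ) : ℕ∞) <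
        tauE n (Dfam n) := by
  obtain ⟨K, hK⟩ := exists_nat_one_div_lt hε
  have htend : Filter.Tendsto (fun n : ℕ => Real.log n) Filter.atTop Filter.atTop :=
    Real.tendsto_log_atTop.comp tendsto_natCast_atTop_atTop
  obtain ⟨n₁, hn₁⟩ := Filter.eventually_atTop.1
    (htend.eventually_ge_atTop (Real.log ((K + 1 : ℕ) + 3) / ε))
  refine ⟨max n₁ (K + 2), fun n hn => ?_⟩
  have hnK : K + 2 ≤ n := (le_max_right _ _).trans hn
  have hlarge := hn₁ n ((le_max_left _ _).trans hn)
  rw [div_le_iff₀' hε] at hlarge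
  have hn2 : (2 : ℝ) ≤ n := by exact_mod_cast (by omega : 2 ≤ n)
  have hlog0 : 0 ≤ Real.log n := Real.log_nonneg (by linarith)
  have hlogn : Real.log n ≤ n - 1 := Real.log_le_sub_one_of_pos (by linarith)
  set x := ((n : ℝ) - 1) * ((n : ℝ) - 2) / 4 + (1 / 4 - ε) * Real.log n with hx
  have hεlog : 0 ≤ ε * Real.log n := by positivity
  have hT : 2 * ⌊x⌋₊ ≤ Fintype.card (Edge n) := by
    rw [card_edge]
    rcases le_total 0 x with h0 | h0
    · have hfl := Nat.floor_le h0
      have : (2 * ⌊x⌋₊ : ℝ) ≤ n.choose 2 := by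
        rw [Nat.cast_choose_two]
        nlinarith
      exact_mod_cast this
    · simp [Nat.floor_of_nonpos h0]
  have hmain : ∀ sE, Legal n sE → ¬ CoveredBy sE ⌊x⌋₊ := by
    intro sE hE H
    obtain ⟨q, hq, hv, hle⟩ := exists_reachable_card_ge (K := K + 1) hE hT H (by omega) (by omega)
    refine (H q hq hv).not_ge (Nat.floor_le_of_le ?_)
    rw [cast_pred_choose_two (by omega)] at hle
    set L := Real.log ((K + 1 : ℕ) + 3) with hL
    have hL0 : 0 ≤ L := Real.log_nonneg (by push_cast; linarith [(Nat.cast_nonneg K : (0 : ℝ) ≤ K)])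
    have hδ : 1 / (((K + 1 : ℕ) : ℝ) + 1) ≤ ε := by
      refine le_trans ?_ hK.le
      push_cast
      gcongr
      linarith
    have hδ0 : 0 ≤ 1 / (((K + 1 : ℕ) : ℝ) + 1) := by positivity
    set δ := 1 / (((K + 1 : ℕ) : ℝ) + 1)
    have h1 : δ * Real.log n ≤ ε * Real.log n := by gcongr
    have h2 : 0 ≤ δ * L := by positivity
    rw [hx]
    nlinarith
  refine (ENat.add_one_le_iff (ENat.natCast_ne_top _)).1 (le_sInf ?_)
  rintro _ ⟨t, ht, rfl⟩
  have : ⌊x⌋₊ + 1 ≤ t := by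
    by_contra hlt
    exact not_enforcerWinsBy hmain (by omega) ht
  change (⌊x⌋₊ : ℕ∞) + 1 ≤ (t : ℕ∞)
  exact_mod_cast this
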